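/- arXiv:2604.17639 — 2 statements merged into one kernel-verified Lean document; each statement's English description precedes it below -/
import Mathlib

section
/- Let ν, ρ > 0 and let ψ : ℝ^d → ℝ be a smooth even function, 2π-periodic in each coordinate, with Fourier expansion ψ(x) = c₀ + ½ Σ_{k∈ℤ^d\{0}} c_k cos(k·x) (c_k = c_{−k}, Σ_k |c_k||k|² < ∞). Suppose u, m : ℝ^d → ℝ are twice continuously differentiable and 2π-periodic in each coordinate, m > 0 with ∫_{[0,2π]^d} m = 1, m(x) = exp(−u(x)/ν)/∫_{[0,2π]^d} exp(−u(y)/ν) dy, and the stationary mean-field game system holds: ρ u − ν Δu + ½|∇u|² = 2 ∫_{[0,2π]^d} ψ(x−y) m(y) dy for all x, and ν Δm + ∇·(m ∇u) = 0. Then − Σ_{k∈ℤ^d\{0}} c_k |k|² q_k(m) ≥ ν(ρ+ν) ∫_{[0,2π]^d} |∇m|²/m dx. -/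
open Real MeasureTheory

/-- Partial derivative of `f : ℝ^d → ℝ` in the `i`-th coordinate direction. -/
noncomputable def pd {d : ℕ} (f : (Fin d → ℝ) → ℝ) (i : Fin d) (x : Fin d → ℝ) : ℝ :=
  fderiv ℝ f x (Pi.single i 1)

/-- The fundamental cube `[0,2π]^d` of the torus `𝕋^d = (ℝ/2πℤ)^d`. -/
noncomputable def torusBox (d : ℕ) : Set (Fin d → ℝ) :=
  Set.Icc 0 (fun _ => 2 * π)


section Parseval

open scoped Pointwise

@[reducible] noncomputable def uacMS : MeasureSpace UnitAddCircle := ⟨AddCircle.haarAddCircle⟩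

attribute [local instance] uacMS

theorem uacProb : IsProbabilityMeasure (volume : Measure UnitAddCircle) :=
  inferInstanceAs (IsProbabilityMeasure AddCircle.haarAddCircle)

attribute [local instance] uacProb

/-- Cosine coefficient. -/
noncomputable def cC {d : ℕ} (k : Fin d → ℤ) (f : (Fin d → ℝ) → ℝ) : ℝ :=
  ∫ x in torusBox d, Real.cos (∑ i, (k i : ℝ) * x i) * f x

/-- Sine coefficient. -/
noncomputable def sC {d : ℕ} (k : Fin d → ℤ) (f : (Fin d → ℝ) → ℝ) : ℝ :=
  ∫ x in torusBox d, Real.sin (∑ i, (k i : ℝ) * x i) * f x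

theorem intBox {d : ℕ} {E : Type*} [NormedAddCommGroup E] {f : (Fin d → ℝ) → E}
    (hf : Continuous f) : IntegrableOn f (torusBox d) :=
  hf.continuousOn.integrableOn_compact isCompact_Icc

theorem torus_int {d : ℕ} {E : Type*} [NormedAddCommGroup E] [NormedSpace ℝ E]
    (H : UnitAddTorus (Fin d) → E) (h : (Fin d → ℝ) → E)
    (hH : ∀ x : Fin d → ℝ, (∀ i, x i ∈ Set.Ioc (0:ℝ) 1) →
      H (fun i => (x i : UnitAddCircle)) = h ((2 * π) • x)) :
    ∫ z, H z = ((2 * π) ^ d)⁻¹ • ∫ x in torusBox d, h x := by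
  have h1 := UnitAddTorus.integral_preimage H (0 : Fin d → ℝ)
  have h2 : {x : Fin d → ℝ | ∀ i, x i ∈ Set.Ioc ((0 : Fin d → ℝ) i) ((0 : Fin d → ℝ) i + 1)}
      = Set.pi Set.univ (fun _ => Set.Ioc (0:ℝ) 1) := by
    ext x; simp
  rw [h2] at h1
  have h3 : ∫ x in Set.pi Set.univ (fun _ : Fin d => Set.Ioc (0:ℝ) 1),
      H (fun i => (x i : UnitAddCircle)) =
      ∫ x in Set.pi Set.univ (fun _ : Fin d => Set.Ioc (0:ℝ) 1), h ((2 * π) • x) := by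
    apply setIntegral_congr_fun
    · exact MeasurableSet.univ_pi fun _ => measurableSet_Ioc
    · intro x hx
      exact hH x (fun i => hx i (Set.mem_univ i))
  have h4 : Set.pi Set.univ (fun _ : Fin d => Set.Ioc (0:ℝ) 1) =ᵐ[volume]
      Set.Icc (0 : Fin d → ℝ) (fun _ => 1) := by
    have := Measure.univ_pi_Ioc_ae_eq_Icc (μ := fun _ : Fin d => (volume : Measure ℝ))
      (f := (0 : Fin d → ℝ)) (g := fun _ => 1)
    simpa [volume_pi] using this
  have h5 : (2 * π) • Set.Icc (0 : Fin d → ℝ) (fun _ => 1) = torusBox d := by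
    have hp : (0:ℝ) < 2 * π := by positivity
    ext x
    rw [Set.mem_smul_set_iff_inv_smul_mem₀ hp.ne']
    simp only [torusBox, Set.mem_Icc, Pi.le_def, Pi.smul_apply, smul_eq_mul, Pi.zero_apply]
    refine and_congr (forall_congr' fun i => ?_) (forall_congr' fun i => ?_)
    · rw [mul_nonneg_iff_of_pos_left (by positivity)]
    · rw [inv_mul_le_iff₀ hp, mul_one]
  calc ∫ z, H z = _ := h1
    _ = _ := h3
    _ = _ := by
      rw [setIntegral_congr_set h4, Measure.setIntegral_comp_smul_of_pos volume h _ (by positivity),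
        h5]
      simp

theorem mF_eq {d : ℕ} (k : Fin d → ℤ) (x : Fin d → ℝ) :
    UnitAddTorus.mFourier (-k) (fun i => (x i : UnitAddCircle)) =
      (Real.cos (∑ i, (k i : ℝ) * ((2 * π) • x) i) : ℂ)
        - Complex.I * (Real.sin (∑ i, (k i : ℝ) * ((2 * π) • x) i) : ℂ) := by
  have : UnitAddTorus.mFourier (-k) (fun i => (x i : UnitAddCircle)) =
      Complex.exp ((-(∑ i, (k i : ℝ) * ((2 * π) • x) i) : ℝ) * Complex.I) := by
    simp only [UnitAddTorus.mFourier, ContinuousMap.coe_mk, fourier_coe_apply]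
    rw [← Complex.exp_sum]
    congr 1
    push_cast
    rw [← Finset.sum_neg_distrib, Finset.sum_mul]
    refine Finset.sum_congr rfl fun i _ => ?_
    simp
    ring
  rw [this, Complex.exp_mul_I, ← Complex.ofReal_cos, ← Complex.ofReal_sin, Real.cos_neg,
    Real.sin_neg]
  push_cast
  ring

/-- Lift. -/
noncomputable def liftT {d : ℕ} (f : (Fin d → ℝ) → ℝ) (z : UnitAddTorus (Fin d)) : ℂ :=
  (f ((2 * π) • fun i => (AddCircle.measurableEquivIoc 1 0 (z i) : ℝ)) : ℂ)

theorem liftT_apply {d : ℕ} (f : (Fin d → ℝ) → ℝ) (x : Fin d → ℝ)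
    (hx : ∀ i, x i ∈ Set.Ioc (0:ℝ) 1) :
    liftT f (fun i => (x i : UnitAddCircle)) = (f ((2 * π) • x) : ℂ) := by
  unfold liftT
  congr 3
  ext i
  have := AddCircle.equivIoc_coe_eq (p := (1:ℝ)) (a := 0) (x := x i) (by simpa using hx i)
  change ((AddCircle.equivIoc 1 0 (x i : UnitAddCircle)) : ℝ) = x i
  rw [this]

theorem liftT_memLp {d : ℕ} {f : (Fin d → ℝ) → ℝ} (hf : Continuous f) :
    MemLp (liftT f) 2 (volume : Measure (UnitAddTorus (Fin d))) := by
  obtain ⟨B, hB⟩ := (isCompact_Icc (a := (0 : Fin d → ℝ)) (b := fun _ => 2 * π)).exists_bound_of_continuousOn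
    hf.continuousOn
  have hmeas : Measurable (liftT f) := by
    unfold liftT
    apply Complex.measurable_ofReal.comp
    apply hf.measurable.comp
    refine Measurable.fun_const_smul ?_ _
    apply measurable_pi_lambda
    intro i
    exact measurable_subtype_coe.comp
      ((AddCircle.measurableEquivIoc 1 0).measurable.comp (measurable_pi_apply i))
  refine MemLp.of_bound hmeas.aestronglyMeasurable B (Filter.Eventually.of_forall fun z => ?_)
  unfold liftT
  rw [Complex.norm_real]
  apply hB
  have hp : (0:ℝ) < 2 * π := by positivity
  constructor
  · intro i
    have := (AddCircle.measurableEquivIoc 1 0 (z i)).2.1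
    simp only [Pi.zero_apply, Pi.smul_apply, smul_eq_mul]
    positivity
  · intro i
    have := (AddCircle.measurableEquivIoc 1 0 (z i)).2.2
    simp only [Pi.smul_apply, smul_eq_mul]
    nlinarith

theorem coeff_lift {d : ℕ} {f : (Fin d → ℝ) → ℝ} (hf : Continuous f) (k : Fin d → ℤ) :
    UnitAddTorus.mFourierCoeff (liftT f) k =
      (((2 * π) ^ d)⁻¹ : ℝ) * ((cC k f : ℂ) - Complex.I * (sC k f : ℂ)) := by
  unfold UnitAddTorus.mFourierCoeff
  rw [torus_int _ (fun y => ((Real.cos (∑ i, (k i : ℝ) * y i) * f y : ℝ) : ℂ)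
        - Complex.I * ((Real.sin (∑ i, (k i : ℝ) * y i) * f y : ℝ) : ℂ))]
  · rw [integral_sub, integral_const_mul, integral_complex_ofReal, integral_complex_ofReal]
    · rw [Complex.real_smul]; rfl
    · exact intBox (by fun_prop)
    · exact intBox (by fun_prop)
  · intro x hx
    rw [mF_eq, liftT_apply f x hx, smul_eq_mul]
    push_cast
    ring

theorem parseval {d : ℕ} {f g : (Fin d → ℝ) → ℝ} (hf : Continuous f) (hg : Continuous g) :
    HasSum (fun k : Fin d → ℤ => cC k f * cC k g + sC k f * sC k g)
      ((2 * π) ^ d * ∫ x in torusBox d, f x * g x) := by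
  have h := UnitAddTorus.hasSum_prod_mFourierCoeff (liftT_memLp hf).toLp (liftT_memLp hg).toLp
  have e : ∀ {f : (Fin d → ℝ) → ℝ} (hf : Continuous f) (k), UnitAddTorus.mFourierCoeff
      (MemLp.toLp (liftT f) (liftT_memLp hf)) k =
      (((2 * π) ^ d)⁻¹ : ℝ) * ((cC k f : ℂ) - Complex.I * (sC k f : ℂ)) := by
    intro f hf k
    rw [← coeff_lift hf]
    unfold UnitAddTorus.mFourierCoeff
    apply integral_congr_ae
    filter_upwards [(liftT_memLp hf).coeFn_toLp] with z hz
    rw [hz]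
  have e2 : ∫ t, (starRingEnd ℂ) ((MemLp.toLp (liftT f) (liftT_memLp hf)) t) *
      (MemLp.toLp (liftT g) (liftT_memLp hg)) t =
      (((2 * π) ^ d)⁻¹ * ∫ x in torusBox d, f x * g x : ℝ) := by
    calc _ = ∫ t, (starRingEnd ℂ) (liftT f t) * liftT g t := by
          apply integral_congr_ae
          filter_upwards [(liftT_memLp hf).coeFn_toLp, (liftT_memLp hg).coeFn_toLp] with z hz hz'
          rw [hz, hz']
      _ = _ := by
          rw [torus_int _ (fun y => ((f y * g y : ℝ) : ℂ))]
          · rw [integral_complex_ofReal, Complex.real_smul]; push_cast; rfl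
          · intro x hx
            rw [liftT_apply f x hx, liftT_apply g x hx, Complex.conj_ofReal]
            push_cast; rfl
  simp only [e hf, e hg] at h
  rw [e2] at h
  have h' := (Complex.hasSum_re h).mul_left (((2 * π) ^ d) ^ 2)
  have hp : ((2 * π) ^ d) ≠ 0 := by positivity
  clear e e2 h
  generalize (2 * π) ^ d = N at *
  convert! h' using 1
  · ext k
    have : ∀ a b c d : ℝ, ((starRingEnd ℂ) (((N⁻¹ : ℝ) : ℂ) * ((a : ℂ) - Complex.I * (b : ℂ))) *
        (((N⁻¹ : ℝ) : ℂ) * ((c : ℂ) - Complex.I * (d : ℂ)))).re = N⁻¹ * N⁻¹ * (a * c + b * d) := by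
      intro a b c d
      simp [Complex.mul_re, Complex.mul_im, -Complex.ofReal_inv]
      ring
    rw [this]
    field_simp
  · rw [Complex.ofReal_re]
    field_simp

end Parseval

section Calc

/-- Periodicity. -/
def PerF {d : ℕ} (f : (Fin d → ℝ) → ℝ) : Prop :=
  ∀ (x : Fin d → ℝ) (i : Fin d), f (x + Pi.single i (2 * π)) = f x

variable {d : ℕ}

theorem pd_cont {f : (Fin d → ℝ) → ℝ} (hf : ContDiff ℝ 1 f) (i : Fin d) :
    Continuous (pd f i) := by
  unfold pd
  exact (hf.continuous_fderiv (by norm_num)).clm_apply continuous_const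

theorem pd_contDiff {f : (Fin d → ℝ) → ℝ} (hf : ContDiff ℝ 2 f) (i : Fin d) :
    ContDiff ℝ 1 (pd f i) := by
  unfold pd
  exact (hf.fderiv_right (m := 1) (by norm_num)).clm_apply contDiff_const

theorem pd_per {f : (Fin d → ℝ) → ℝ} (hf : PerF f) (i : Fin d) : PerF (pd f i) := by
  intro x j
  unfold pd
  rw [← fderiv_comp_add_right]
  congr 2
  ext y
  exact hf y j

theorem pd_of {f : (Fin d → ℝ) → ℝ} {f' : (Fin d → ℝ) →L[ℝ] ℝ} {x : Fin d → ℝ}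
    (h : HasFDerivAt f f' x) (i : Fin d) : pd f i x = f' (Pi.single i 1) := by
  unfold pd; rw [h.fderiv]

theorem hfd {f : (Fin d → ℝ) → ℝ} (hf : ContDiff ℝ 1 f) (x : Fin d → ℝ) :
    HasFDerivAt f (fderiv ℝ f x) x :=
  (hf.differentiable (by norm_num) x).hasFDerivAt

theorem pd_mul {f g : (Fin d → ℝ) → ℝ} (hf : ContDiff ℝ 1 f) (hg : ContDiff ℝ 1 g) (i : Fin d)
    (x : Fin d → ℝ) : pd (fun y => f y * g y) i x = f x * pd g i x + pd f i x * g x := by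
  rw [pd_of (f := fun y => f y * g y) ((hfd hf x).mul (hfd hg x))]
  simp [pd]
  ring

theorem pd_const_mul {f : (Fin d → ℝ) → ℝ} (hf : ContDiff ℝ 1 f) (c : ℝ) (i : Fin d)
    (x : Fin d → ℝ) : pd (fun y => c * f y) i x = c * pd f i x := by
  rw [pd_of ((hfd hf x).const_mul c)]
  simp [pd]

theorem pd_inv {f : (Fin d → ℝ) → ℝ} (hf : ContDiff ℝ 1 f) (hp : ∀ x, 0 < f x) (i : Fin d)
    (x : Fin d → ℝ) : pd (fun y => (f y)⁻¹) i x = - pd f i x / f x ^ 2 := by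
  have := (hasDerivAt_inv (hp x).ne').comp_hasFDerivAt x (hfd hf x)
  rw [pd_of (f := fun y => (f y)⁻¹) this]
  simp [pd]
  field_simp

theorem pd_exp {f : (Fin d → ℝ) → ℝ} (hf : ContDiff ℝ 1 f) (i : Fin d)
    (x : Fin d → ℝ) : pd (fun y => Real.exp (f y)) i x = Real.exp (f x) * pd f i x := by
  rw [pd_of ((hfd hf x).exp)]
  simp [pd]

theorem lin_hfd (k : Fin d → ℤ) (x : Fin d → ℝ) :
    HasFDerivAt (fun x : Fin d → ℝ => ∑ i, (k i : ℝ) * x i)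
      (∑ i, (k i : ℝ) • (ContinuousLinearMap.proj i : (Fin d → ℝ) →L[ℝ] ℝ)) x := by
  apply HasFDerivAt.fun_sum
  intro i _
  exact (hasFDerivAt_apply i x).const_mul _

theorem pd_cos (k : Fin d → ℤ) (i : Fin d) (x : Fin d → ℝ) :
    pd (fun x => Real.cos (∑ i, (k i : ℝ) * x i)) i x =
      - (k i : ℝ) * Real.sin (∑ i, (k i : ℝ) * x i) := by
  rw [pd_of (lin_hfd k x).cos]
  simp [Pi.single_apply]
  ring

theorem pd_sin (k : Fin d → ℤ) (i : Fin d) (x : Fin d → ℝ) :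
    pd (fun x => Real.sin (∑ i, (k i : ℝ) * x i)) i x =
      (k i : ℝ) * Real.cos (∑ i, (k i : ℝ) * x i) := by
  rw [pd_of (lin_hfd k x).sin]
  simp [Pi.single_apply]
  ring

theorem lin_shift (k : Fin d → ℤ) (i : Fin d) (x : Fin d → ℝ) :
    ∑ j, (k j : ℝ) * (x + Pi.single i (2 * π) : Fin d → ℝ) j = ∑ j, (k j : ℝ) * x j + (k i : ℝ) * (2 * π) := by
  simp [mul_add, Finset.sum_add_distrib, Pi.single_apply]

theorem per_cos (k : Fin d → ℤ) : PerF (fun x => Real.cos (∑ i, (k i : ℝ) * x i)) := by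
  intro x i
  simp only
  rw [lin_shift, Real.cos_add_int_mul_two_pi]

theorem per_sin (k : Fin d → ℤ) : PerF (fun x => Real.sin (∑ i, (k i : ℝ) * x i)) := by
  intro x i
  simp only
  rw [lin_shift, Real.sin_add_int_mul_two_pi]

theorem cd_cos (k : Fin d → ℤ) {n} : ContDiff ℝ n (fun x : Fin d → ℝ => Real.cos (∑ i, (k i : ℝ) * x i)) := by
  fun_prop

theorem cd_sin (k : Fin d → ℤ) {n} : ContDiff ℝ n (fun x : Fin d → ℝ => Real.sin (∑ i, (k i : ℝ) * x i)) := by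
  fun_prop

theorem box_int_pd {f : (Fin d → ℝ) → ℝ} (hf : ContDiff ℝ 1 f) (hp : PerF f) (i : Fin d) :
    ∫ x in torusBox d, pd f i x = 0 := by
  cases d with
  | zero => exact i.elim0
  | succ n =>
    have hle : (0 : Fin (n+1) → ℝ) ≤ fun _ => 2 * π := fun _ => by
      simp only [Pi.zero_apply]; positivity
    have hs : ∀ x, ∑ j, (if j = i then fderiv ℝ f x else 0) (Pi.single j (1:ℝ)) = pd f i x := by
      intro x
      rw [Finset.sum_eq_single i]
      · simp [pd]
      · intro j _ hj; simp [hj]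
      · simp
    have := integral_divergence_of_hasFDerivAt_off_countable' (0 : Fin (n+1) → ℝ)
      (fun _ => 2 * π) hle (fun j => if j = i then f else 0)
      (fun j x => if j = i then fderiv ℝ f x else 0) ∅ Set.countable_empty
      (fun j => by
        split_ifs
        · exact hf.continuous.continuousOn
        · exact continuousOn_const)
      (fun x _ j => by
        split_ifs
        · exact hfd hf x
        · exact hasFDerivAt_const 0 x)
      (by
        simp only [hs]
        exact intBox (pd_cont hf i))
    simp only [hs] at this
    unfold torusBox
    rw [this]
    apply Finset.sum_eq_zero
    intro j _
    rw [sub_eq_zero]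
    congr 1
    ext x
    by_cases hj : j = i
    · simp only [hj, if_true]
      refine Eq.trans ?_ (hp _ i)
      congr 1
      ext l
      refine Fin.succAboveCases i ?_ ?_ l
      · simp
      · intro l; simp [Fin.succAbove_ne]
    · simp [hj]

theorem per_mul {f g : (Fin d → ℝ) → ℝ} (hf : PerF f) (hg : PerF g) :
    PerF (fun x => f x * g x) := fun x i => by simp only [hf x i, hg x i]

theorem ibp {f g : (Fin d → ℝ) → ℝ} (hf : ContDiff ℝ 1 f) (hg : ContDiff ℝ 1 g)
    (pf : PerF f) (pg : PerF g) (i : Fin d) :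
    ∫ x in torusBox d, f x * pd g i x = - ∫ x in torusBox d, pd f i x * g x := by
  have h := box_int_pd (hf.mul hg) (per_mul pf pg) i
  simp only [pd_mul hf hg] at h
  rw [integral_add] at h
  · linarith
  · exact intBox (hf.continuous.mul (pd_cont hg i))
  · exact intBox ((pd_cont hf i).mul hg.continuous)

theorem cC_pd {f : (Fin d → ℝ) → ℝ} (hf : ContDiff ℝ 1 f) (pf : PerF f) (i : Fin d)
    (k : Fin d → ℤ) : cC k (pd f i) = (k i : ℝ) * sC k f := by
  unfold cC sC
  rw [ibp (cd_cos k) hf (per_cos k) pf]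
  simp only [pd_cos, mul_assoc, neg_mul]
  rw [integral_neg, integral_const_mul, neg_neg]

theorem sC_pd {f : (Fin d → ℝ) → ℝ} (hf : ContDiff ℝ 1 f) (pf : PerF f) (i : Fin d)
    (k : Fin d → ℤ) : sC k (pd f i) = - (k i : ℝ) * cC k f := by
  unfold cC sC
  rw [ibp (cd_sin k) hf (per_sin k) pf]
  simp only [pd_sin, mul_assoc]
  rw [integral_const_mul, neg_mul]

theorem cC_pd2 {f : (Fin d → ℝ) → ℝ} (hf : ContDiff ℝ 2 f) (pf : PerF f) (i j : Fin d)
    (k : Fin d → ℤ) : cC k (pd (pd f i) j) = - (k i : ℝ) * k j * cC k f := by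
  rw [cC_pd (pd_contDiff hf i) (pd_per pf i), sC_pd (hf.of_le (by norm_num)) pf]; ring

theorem sC_pd2 {f : (Fin d → ℝ) → ℝ} (hf : ContDiff ℝ 2 f) (pf : PerF f) (i j : Fin d)
    (k : Fin d → ℤ) : sC k (pd (pd f i) j) = - (k i : ℝ) * k j * sC k f := by
  rw [sC_pd (pd_contDiff hf i) (pd_per pf i), cC_pd (hf.of_le (by norm_num)) pf]; ring

theorem swap2 {f : (Fin d → ℝ) → ℝ} (hf : ContDiff ℝ 2 f) (pf : PerF f) (i j : Fin d) :
    ∫ x in torusBox d, pd (pd f i) i x * pd (pd f j) j x =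
    ∫ x in torusBox d, pd (pd f i) j x * pd (pd f i) j x := by
  have c2 : ∀ i j, Continuous (pd (pd f i) j) := fun i j => pd_cont (pd_contDiff hf i) j
  have h1 := parseval (c2 i i) (c2 j j)
  have h2 := parseval (c2 i j) (c2 i j)
  simp only [cC_pd2 hf pf, sC_pd2 hf pf] at h1 h2
  have h3 := h1.unique (by convert! h2 using 1; ext k; ring)
  exact mul_left_cancel₀ (by positivity) h3

theorem wirt {f : (Fin d → ℝ) → ℝ} (hf : ContDiff ℝ 2 f) (pf : PerF f) (i : Fin d) :
    ∫ x in torusBox d, pd f i x * pd f i x ≤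
    ∫ x in torusBox d, pd (pd f i) i x * pd (pd f i) i x := by
  have hf1 : ContDiff ℝ 1 f := hf.of_le (by norm_num)
  have h1 := parseval (pd_cont hf1 i) (pd_cont hf1 i)
  have h2 := parseval (pd_cont (pd_contDiff hf i) i) (pd_cont (pd_contDiff hf i) i)
  have h3 := hasSum_le (fun k => ?_) h1 h2
  · exact le_of_mul_le_mul_left h3 (by positivity)
  · rw [cC_pd2 hf pf, sC_pd2 hf pf, cC_pd hf1 pf, sC_pd hf1 pf]
    have hk : ((k i : ℝ)) ^ 2 ≤ ((k i : ℝ)) ^ 4 := by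
      have : (k i) ^ 2 ≤ (k i) ^ 4 := by
        by_cases h : k i = 0
        · simp [h]
        · have : 1 ≤ (k i) ^ 2 := by have := sq_pos_of_ne_zero h; omega
          nlinarith
      exact_mod_cast this
    nlinarith [mul_le_mul_of_nonneg_right hk (by positivity : 0 ≤ cC k f ^ 2 + sC k f ^ 2)]

theorem cross {g : (Fin d → ℝ) → ℝ} (hg : ContDiff ℝ 2 g) (pg : PerF g) (hpos : ∀ x, 0 < g x)
    (i j : Fin d) :
    ∫ x in torusBox d, (pd g i x ^ 2 / g x) * pd (pd g j) j x =
    ∫ x in torusBox d, (pd g i x ^ 2 * pd g j x ^ 2 / g x ^ 2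
      - 2 * (pd g i x * pd g j x * pd (pd g i) j x / g x)) := by
  have hg1 : ContDiff ℝ 1 g := hg.of_le (by norm_num)
  have hi := pd_contDiff hg i
  have hinv : ContDiff ℝ 1 (fun x => (g x)⁻¹) := hg1.inv (fun x => (hpos x).ne')
  have hw : ContDiff ℝ 1 (fun x => (pd g i x * pd g i x) * (g x)⁻¹) := (hi.mul hi).mul hinv
  have pw : PerF (fun x => (pd g i x * pd g i x) * (g x)⁻¹) :=
    per_mul (per_mul (pd_per pg i) (pd_per pg i)) (fun x i => by simp only [pg x i])
  have h := ibp hw (pd_contDiff hg j) pw (pd_per pg j) j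
  calc _ = _ := by
        congr 1; ext x; rw [pow_two, div_eq_mul_inv]
    _ = _ := h
    _ = _ := by
      rw [← integral_neg]
      congr 1
      ext x
      have := (hpos x).ne'
      rw [pd_mul (hi.mul hi) hinv, pd_mul hi hi, pd_inv hg1 hpos]
      field_simp
      ring

theorem key {g : (Fin d → ℝ) → ℝ} (hg : ContDiff ℝ 2 g) (pg : PerF g) (hpos : ∀ x, 0 < g x) :
    ∫ x in torusBox d, ∑ i, pd g i x ^ 2 ≤
    ∫ x in torusBox d, (∑ i, pd (pd g i) i x) * (∑ i, pd (pd g i) i x + (∑ i, pd g i x ^ 2) / g x) := by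
  have hg1 : ContDiff ℝ 1 g := hg.of_le (by norm_num)
  have c0 : Continuous g := hg.continuous
  have c1 : ∀ i, Continuous (pd g i) := fun i => pd_cont hg1 i
  have c2 : ∀ i j, Continuous (pd (pd g i) j) := fun i j => pd_cont (pd_contDiff hg i) j
  have hne : ∀ x, g x ≠ 0 := fun x => (hpos x).ne'
  have hne2 : ∀ x, g x ^ 2 ≠ 0 := fun x => pow_ne_zero 2 (hpos x).ne'
  have cw : ∀ i j, Continuous (fun x => (pd g i x ^ 2 / g x) * pd (pd g j) j x) := fun i j =>
    (((c1 i).pow 2).div₀ c0 hne).mul (c2 j j)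
  have ce : ∀ i j, Continuous (fun x => pd g i x ^ 2 * pd g j x ^ 2 / g x ^ 2) := fun i j =>
    (((c1 i).pow 2).mul ((c1 j).pow 2)).div₀ (c0.pow 2) hne2
  have cf : ∀ i j, Continuous (fun x => 2 * (pd g i x * pd g j x * pd (pd g i) j x / g x)) :=
    fun i j => continuous_const.mul ((((c1 i).mul (c1 j)).mul (c2 i j)).div₀ c0 hne)
  have cm : ∀ i j k l, Continuous (fun x => pd (pd g i) j x * pd (pd g k) l x) := fun i j k l =>
    (c2 i j).mul (c2 k l)
  have ch : ∀ i j, Continuous (fun x => pd g i x ^ 2 * pd g j x ^ 2 / g x ^ 2 -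
      2 * (pd g i x * pd g j x * pd (pd g i) j x / g x)) := fun i j => (ce i j).sub (cf i j)
  have hT : ∀ i j, (if i = j then ∫ x in torusBox d, pd g i x ^ 2 else 0) ≤
      ∫ x in torusBox d, (pd (pd g i) i x * pd (pd g j) j x
        + (pd g i x ^ 2 / g x) * pd (pd g j) j x) := by
    intro i j
    rw [integral_add (intBox (cm i i j j)) (intBox (cw i j))]
    split_ifs with hij
    · subst hij
      have hw := wirt hg pg i
      have hc := cross hg pg hpos i i
      rw [integral_sub (intBox (ce i i)) (intBox (cf i i)), integral_const_mul] at hc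
      have e1 : ∫ x in torusBox d, pd g i x * pd g i x * pd (pd g i) i x / g x =
          ∫ x in torusBox d, (pd g i x ^ 2 / g x) * pd (pd g i) i x := by
        congr 1; ext x; ring
      have e2 : 0 ≤ ∫ x in torusBox d, pd g i x ^ 2 * pd g i x ^ 2 / g x ^ 2 :=
        integral_nonneg fun x => by positivity
      rw [e1] at hc
      simp only [← pow_two] at hw ⊢
      linarith
    · rw [swap2 hg pg, cross hg pg hpos, ← integral_add (intBox (cm i j i j))
        (intBox (ch i j))]
      apply integral_nonneg
      intro x
      have : pd (pd g i) j x * pd (pd g i) j x + (pd g i x ^ 2 * pd g j x ^ 2 / g x ^ 2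
        - 2 * (pd g i x * pd g j x * pd (pd g i) j x / g x)) =
        (pd (pd g i) j x - pd g i x * pd g j x / g x) ^ 2 := by
        have := hne x
        field_simp
        ring
      change 0 ≤ _
      simp only [this]
      positivity
  calc ∫ x in torusBox d, ∑ i, pd g i x ^ 2 = ∑ i, ∫ x in torusBox d, pd g i x ^ 2 :=
        integral_finsetSum _ fun i _ => intBox ((c1 i).pow 2)
    _ = ∑ i, ∑ j, (if i = j then ∫ x in torusBox d, pd g i x ^ 2 else 0) := by simp
    _ ≤ ∑ i, ∑ j, ∫ x in torusBox d, (pd (pd g i) i x * pd (pd g j) j x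
        + (pd g i x ^ 2 / g x) * pd (pd g j) j x) :=
        Finset.sum_le_sum fun i _ => Finset.sum_le_sum fun j _ => hT i j
    _ = ∫ x in torusBox d, ∑ i, ∑ j, (pd (pd g i) i x * pd (pd g j) j x
        + (pd g i x ^ 2 / g x) * pd (pd g j) j x) := by
        rw [integral_finsetSum]
        · refine Finset.sum_congr rfl fun i _ => ?_
          rw [integral_finsetSum]
          exact fun j _ => intBox (((c2 i i).mul (c2 j j)).add (cw i j))
        · exact fun i _ => intBox (continuous_finsetSum _ fun j _ =>
            ((c2 i i).mul (c2 j j)).add (cw i j))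
    _ = _ := by
        congr 1; ext x
        simp only [Finset.sum_add_distrib, ← Finset.mul_sum, ← Finset.sum_mul, ← Finset.sum_div]
        ring

end Calc

section Main

variable {d : ℕ}

theorem hs_int {K : Type*} [Countable K] (e : K → (Fin d → ℝ) → ℝ) (B : K → ℝ)
    (he : ∀ k, Continuous (e k)) (hB : ∀ k x, |e k x| ≤ B k) (sB : Summable B)
    {w : (Fin d → ℝ) → ℝ} (hw : Continuous w) :
    HasSum (fun k => ∫ x in torusBox d, e k x * w x)
      (∫ x in torusBox d, (∑' k, e k x) * w x) := by
  have h := hasSum_integral_of_summable_integral_norm (μ := volume.restrict (torusBox d))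
    (F := fun k x => e k x * w x) (fun k => intBox ((he k).mul hw)) ?_
  · simpa only [tsum_mul_right] using h
  · refine Summable.of_nonneg_of_le (fun k => integral_nonneg fun x => norm_nonneg _) (fun k => ?_)
      (sB.mul_right (∫ x in torusBox d, |w x|))
    rw [← integral_const_mul]
    refine integral_mono (intBox ((he k).mul hw).norm) (intBox (continuous_const.mul hw.abs)) ?_
    intro x
    simp only [Real.norm_eq_abs, abs_mul]
    exact mul_le_mul_of_nonneg_right (hB k x) (abs_nonneg _)

theorem cC_bd (k : Fin d → ℤ) {w : (Fin d → ℝ) → ℝ} (hw : Continuous w) :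
    |cC k w| ≤ ∫ x in torusBox d, |w x| := by
  unfold cC
  refine (abs_integral_le_integral_abs).trans
    (integral_mono (intBox (by fun_prop)) (intBox hw.abs) fun x => ?_)
  simp only [abs_mul]
  exact mul_le_of_le_one_left (abs_nonneg _) (Real.abs_cos_le_one _)

theorem sC_bd (k : Fin d → ℤ) {w : (Fin d → ℝ) → ℝ} (hw : Continuous w) :
    |sC k w| ≤ ∫ x in torusBox d, |w x| := by
  unfold sC
  refine (abs_integral_le_integral_abs).trans
    (integral_mono (intBox (by fun_prop)) (intBox hw.abs) fun x => ?_)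
  simp only [abs_mul]
  exact mul_le_of_le_one_left (abs_nonneg _) (Real.abs_sin_le_one _)

theorem c_summable {c : (Fin d → ℤ) → ℝ}
    (hcsum : Summable fun k : Fin d → ℤ => |c k| * (∑ i, ((k i : ℝ)) ^ 2)) :
    Summable fun k : {k : Fin d → ℤ // k ≠ 0} => |c k.1| := by
  refine Summable.of_nonneg_of_le (fun k => abs_nonneg _) (fun k => ?_)
    (hcsum.comp_injective (Subtype.val_injective (p := fun k : Fin d → ℤ => k ≠ 0)))
  simp only [Function.comp]
  apply le_mul_of_one_le_right (abs_nonneg _)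
  obtain ⟨i, hi⟩ := Function.ne_iff.mp k.2
  have h1 : (1 : ℝ) ≤ ((k.1 i : ℝ)) ^ 2 := by
    have : 1 ≤ (k.1 i) ^ 2 := by have := sq_pos_of_ne_zero (a := k.1 i) (by simpa using hi); omega
    exact_mod_cast this
  exact h1.trans (Finset.single_le_sum (f := fun i => ((k.1 i : ℝ)) ^ 2)
    (fun i _ => sq_nonneg _) (Finset.mem_univ i))

theorem int_lap {m : (Fin d → ℝ) → ℝ} (hm : ContDiff ℝ 2 m)
    {f : (Fin d → ℝ) → ℝ} (hf : Continuous f) :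
    ∫ x in torusBox d, f x * ∑ i, pd (pd m i) i x =
      ∑ i, ∫ x in torusBox d, f x * pd (pd m i) i x := by
  simp only [Finset.mul_sum]
  exact integral_finsetSum _ fun i _ => intBox (hf.mul (pd_cont (pd_contDiff hm i) i))

theorem pot (ψ : (Fin d → ℝ) → ℝ) 
    (c₀ : ℝ) (c : (Fin d → ℤ) → ℝ)
    (hcsum : Summable fun k : Fin d → ℤ => |c k| * (∑ i, ((k i : ℝ)) ^ 2))
    (hexp : ∀ x, ψ x = c₀ + (1 / 2) *
      ∑' k : {k : Fin d → ℤ // k ≠ 0}, c k.1 * Real.cos (∑ i, (k.1 i : ℝ) * x i))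
    (hψ : Continuous ψ)
    (m : (Fin d → ℝ) → ℝ) (hm : ContDiff ℝ 2 m) (pm : PerF m)
    (hmass : (∫ x in torusBox d, m x) = 1) :
    ∫ x in torusBox d, (2 * ∫ y in torusBox d, ψ (x - y) * m y) * ∑ i, pd (pd m i) i x =
    -∑' k : {k : Fin d → ℤ // k ≠ 0}, c k.1 * (∑ i, ((k.1 i : ℝ)) ^ 2) *
        (cC k.1 m ^ 2 + sC k.1 m ^ 2) := by
  have hs := c_summable hcsum
  have cm := hm.continuous
  have hF : ∀ x, 2 * ∫ y in torusBox d, ψ (x - y) * m y = 2 * c₀ +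
      ∑' k : {k : Fin d → ℤ // k ≠ 0}, c k.1 * (Real.cos (∑ i, (k.1 i : ℝ) * x i) * cC k.1 m +
        Real.sin (∑ i, (k.1 i : ℝ) * x i) * sC k.1 m) := by
    intro x
    have h := hs_int (d := d) (fun (k : {k : Fin d → ℤ // k ≠ 0}) y =>
      c k.1 * Real.cos (∑ i, (k.1 i : ℝ) * (x - y) i)) (fun k => |c k.1|)
      (fun k => by simp only [Pi.sub_apply]; fun_prop)
      (fun k y => by
        rw [abs_mul]; exact mul_le_of_le_one_right (abs_nonneg _) (Real.abs_cos_le_one _))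
      hs cm
    have e1 : ∀ k : {k : Fin d → ℤ // k ≠ 0}, ∫ y in torusBox d,
        c k.1 * Real.cos (∑ i, (k.1 i : ℝ) * (x - y) i) * m y =
        c k.1 * (Real.cos (∑ i, (k.1 i : ℝ) * x i) * cC k.1 m +
        Real.sin (∑ i, (k.1 i : ℝ) * x i) * sC k.1 m) := by
      intro k
      unfold cC sC
      rw [← integral_const_mul, ← integral_const_mul, ← integral_add, ← integral_const_mul]
      · congr 1
        ext y
        have : ∑ i, (k.1 i : ℝ) * (x - y) i =
            ∑ i, (k.1 i : ℝ) * x i - ∑ i, (k.1 i : ℝ) * y i := by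
          simp [mul_sub, Finset.sum_sub_distrib]
        rw [this, Real.cos_sub]
        ring
      · exact intBox (by fun_prop)
      · exact intBox (by fun_prop)
    simp only [e1] at h
    rw [h.tsum_eq]
    have e2 : ∀ y, (∑' k : {k : Fin d → ℤ // k ≠ 0},
        c k.1 * Real.cos (∑ i, (k.1 i : ℝ) * (x - y) i)) = 2 * (ψ (x - y) - c₀) := by
      intro y; rw [hexp (x - y)]; ring
    simp only [e2]
    have e3 : ∀ y, 2 * (ψ (x - y) - c₀) * m y = 2 * (ψ (x - y) * m y) - 2 * c₀ * m y := by
      intro y; ring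
    simp only [e3]
    rw [integral_sub, integral_const_mul, integral_const_mul, hmass]
    · ring
    · exact intBox (by fun_prop)
    · exact intBox (by fun_prop)
  simp only [hF]
  set M := ∫ x in torusBox d, |m x| with hM
  set lap := fun x => ∑ i, pd (pd m i) i x with hlap
  have clap : Continuous lap :=
    continuous_finsetSum _ fun i _ => pd_cont (pd_contDiff hm i) i
  have hbd : ∀ (k : {k : Fin d → ℤ // k ≠ 0}) (x : Fin d → ℝ),
      |c k.1 * (Real.cos (∑ i, (k.1 i : ℝ) * x i) * cC k.1 m +
        Real.sin (∑ i, (k.1 i : ℝ) * x i) * sC k.1 m)| ≤ |c k.1| * (2 * M) := by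
    intro k x
    rw [abs_mul]
    refine mul_le_mul_of_nonneg_left ?_ (abs_nonneg _)
    refine (abs_add_le _ _).trans ?_
    rw [abs_mul, abs_mul, two_mul]
    exact add_le_add
      ((mul_le_of_le_one_left (abs_nonneg _) (Real.abs_cos_le_one _)).trans (cC_bd _ cm))
      ((mul_le_of_le_one_left (abs_nonneg _) (Real.abs_sin_le_one _)).trans (sC_bd _ cm))
  have h := hs_int (d := d) (fun (k : {k : Fin d → ℤ // k ≠ 0}) x =>
      c k.1 * (Real.cos (∑ i, (k.1 i : ℝ) * x i) * cC k.1 m +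
        Real.sin (∑ i, (k.1 i : ℝ) * x i) * sC k.1 m)) (fun k => |c k.1| * (2 * M))
      (fun k => by fun_prop) hbd (hs.mul_right _) clap
  have cser : Continuous (fun x : Fin d → ℝ => ∑' k : {k : Fin d → ℤ // k ≠ 0},
      c k.1 * (Real.cos (∑ i, (k.1 i : ℝ) * x i) * cC k.1 m +
        Real.sin (∑ i, (k.1 i : ℝ) * x i) * sC k.1 m)) :=
    continuous_tsum (fun k => by fun_prop) (hs.mul_right (2 * M)) hbd
  have hl0 : ∫ x in torusBox d, 2 * c₀ * lap x = 0 := by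
    rw [integral_const_mul, hlap, integral_finsetSum]
    · rw [Finset.sum_eq_zero, mul_zero]
      exact fun i _ => box_int_pd (pd_contDiff hm i) (pd_per pm i) i
    · exact fun i _ => intBox (pd_cont (pd_contDiff hm i) i)
  have hC : ∀ k, cC k lap = - (∑ i, ((k i : ℝ)) ^ 2) * cC k m := by
    intro k
    unfold cC
    rw [hlap, int_lap hm (by fun_prop), ← Finset.sum_neg_distrib, Finset.sum_mul]
    refine Finset.sum_congr rfl fun i _ => ?_
    have := cC_pd2 hm pm i i k
    unfold cC at this
    rw [this]; ring
  have hS : ∀ k, sC k lap = - (∑ i, ((k i : ℝ)) ^ 2) * sC k m := by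
    intro k
    unfold sC
    rw [hlap, int_lap hm (by fun_prop), ← Finset.sum_neg_distrib, Finset.sum_mul]
    refine Finset.sum_congr rfl fun i _ => ?_
    have := sC_pd2 hm pm i i k
    unfold sC at this
    rw [this]; ring
  have e4 : ∀ k : {k : Fin d → ℤ // k ≠ 0}, ∫ x in torusBox d,
      c k.1 * (Real.cos (∑ i, (k.1 i : ℝ) * x i) * cC k.1 m +
        Real.sin (∑ i, (k.1 i : ℝ) * x i) * sC k.1 m) * lap x =
      -(c k.1 * (∑ i, ((k.1 i : ℝ)) ^ 2) * (cC k.1 m ^ 2 + sC k.1 m ^ 2)) := by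
    intro k
    have e5 : ∀ x, c k.1 * (Real.cos (∑ i, (k.1 i : ℝ) * x i) * cC k.1 m +
        Real.sin (∑ i, (k.1 i : ℝ) * x i) * sC k.1 m) * lap x =
        c k.1 * cC k.1 m * (Real.cos (∑ i, (k.1 i : ℝ) * x i) * lap x) +
        c k.1 * sC k.1 m * (Real.sin (∑ i, (k.1 i : ℝ) * x i) * lap x) := by
      intro x; ring
    simp only [e5]
    rw [integral_add, integral_const_mul, integral_const_mul]
    · change c k.1 * cC k.1 m * cC k.1 lap + c k.1 * sC k.1 m * sC k.1 lap = _
      rw [hC, hS]; ring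
    · exact intBox (by fun_prop)
    · exact intBox (by fun_prop)
  simp only [e4] at h
  rw [← tsum_neg, h.tsum_eq]
  simp only [add_mul]
  rw [integral_add, hl0, zero_add]
  · exact intBox (continuous_const.mul clap)
  · exact intBox (cser.mul clap)

end Main

/-- For a stationary equilibrium `(u,m)` of the potential mean-field
game on `𝕋^d` with discount `ρ > 0`, noise `ν > 0`, and interaction kernel `ψ` with
Fourier expansion `ψ(x) = c₀ + ½ Σ_{k≠0} c_k cos(k·x)`, one has
`− Σ_{k≠0} c_k |k|² q_k(m) ≥ ν(ρ+ν) I(m)`. -/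
theorem stationary_equilibrium_fourier_bound (d : ℕ) (ν ρ : ℝ)
    (hν : 0 < ν) (hρ : 0 < ρ)
    (ψ : (Fin d → ℝ) → ℝ) (hψ : ContDiff ℝ (⊤ : ℕ∞) ψ) (hψeven : ∀ x, ψ (-x) = ψ x)
    (hψper : ∀ (x : Fin d → ℝ) (i : Fin d), ψ (x + Pi.single i (2 * π)) = ψ x)
    (c₀ : ℝ) (c : (Fin d → ℤ) → ℝ) (hcsymm : ∀ k, c (-k) = c k)
    (hcsum : Summable fun k : Fin d → ℤ => |c k| * (∑ i, ((k i : ℝ)) ^ 2))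
    (hexp : ∀ x, ψ x = c₀ + (1 / 2) *
      ∑' k : {k : Fin d → ℤ // k ≠ 0}, c k.1 * Real.cos (∑ i, (k.1 i : ℝ) * x i))
    (u m : (Fin d → ℝ) → ℝ) (hu : ContDiff ℝ 2 u) (hm : ContDiff ℝ 2 m)
    (huper : ∀ (x : Fin d → ℝ) (i : Fin d), u (x + Pi.single i (2 * π)) = u x)
    (hmper : ∀ (x : Fin d → ℝ) (i : Fin d), m (x + Pi.single i (2 * π)) = m x)
    (hmpos : ∀ x, 0 < m x) (hmass : (∫ x in torusBox d, m x) = 1)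
    (hgibbs : ∀ x, m x =
      Real.exp (-u x / ν) / ∫ y in torusBox d, Real.exp (-u y / ν))
    (hHJB : ∀ x, ρ * u x - ν * (∑ i, pd (pd u i) i x) + (1 / 2) * (∑ i, (pd u i x) ^ 2) =
      2 * ∫ y in torusBox d, ψ (x - y) * m y)
    (hFP : ∀ x, ν * (∑ i, pd (pd m i) i x) +
      (∑ i, pd (fun y => m y * pd u i y) i x) = 0) :
    ν * (ρ + ν) * (∫ x in torusBox d, (∑ i, (pd m i x) ^ 2) / m x) ≤
      -∑' k : {k : Fin d → ℤ // k ≠ 0}, c k.1 * (∑ i, ((k.1 i : ℝ)) ^ 2) *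
        ((∫ x in torusBox d, Real.cos (∑ i, (k.1 i : ℝ) * x i) * m x) ^ 2 +
          (∫ x in torusBox d, Real.sin (∑ i, (k.1 i : ℝ) * x i) * m x) ^ 2) := by
  have hu1 : ContDiff ℝ 1 u := hu.of_le (by norm_num)
  have hpot := pot ψ c₀ c hcsum hexp hψ.continuous m hm hmper hmass
  set Z := ∫ y in torusBox d, Real.exp (-u y / ν) with hZ
  have hZpos : 0 < Z := by
    have h := hmpos 0
    rw [hgibbs 0] at h
    exact (div_pos_iff_of_pos_left (Real.exp_pos _)).mp h
  obtain ⟨g, hgdef⟩ : ∃ g : (Fin d → ℝ) → ℝ, g = fun x => Real.exp ((-(1 / (2 * ν))) * u x) :=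
    ⟨_, rfl⟩
  have hgpos : ∀ x, 0 < g x := fun x => by rw [hgdef]; exact Real.exp_pos _
  have hgne : ∀ x, g x ≠ 0 := fun x => (hgpos x).ne'
  have hg : ContDiff ℝ 2 g := by rw [hgdef]; exact (contDiff_const.mul hu).exp
  have hg1 : ContDiff ℝ 1 g := hg.of_le (by norm_num)
  have pg : PerF g := by
    intro x i; rw [hgdef]; simp only [huper x i]
  have hmg : m = fun x => Z⁻¹ * (g x * g x) := by
    ext x
    rw [hgibbs x, hgdef]
    simp only
    rw [← Real.exp_add, div_eq_inv_mul]
    congr 2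
    field_simp
    ring
  have hgi : ∀ i x, pd g i x = g x * (-(1 / (2 * ν)) * pd u i x) := by
    intro i x
    rw [hgdef, pd_exp (contDiff_const.mul hu1), pd_const_mul hu1]
  have hui : ∀ i, pd u i = fun x => (-2 * ν) * (pd g i x * (g x)⁻¹) := by
    intro i; ext x
    rw [hgi]
    have := hgne x
    field_simp
  have hinv : ContDiff ℝ 1 (fun x => (g x)⁻¹) := hg1.inv hgne
  have hgi1 : ∀ i, ContDiff ℝ 1 (pd g i) := fun i => pd_contDiff hg i
  have huii : ∀ i x, pd (pd u i) i x =
      (-2 * ν) * (pd (pd g i) i x / g x - pd g i x ^ 2 / g x ^ 2) := by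
    intro i x
    rw [hui i, pd_const_mul ((hgi1 i).mul hinv), pd_mul (hgi1 i) hinv, pd_inv hg1 hgpos]
    have := hgne x
    field_simp
    ring
  have hmi : ∀ i, pd m i = fun x => (2 * Z⁻¹) * (g x * pd g i x) := by
    intro i; ext x
    rw [hmg, pd_const_mul (hg1.mul hg1), pd_mul hg1 hg1]
    ring
  have hmii : ∀ i x, pd (pd m i) i x = 2 * Z⁻¹ * (g x * pd (pd g i) i x + pd g i x ^ 2) := by
    intro i x
    rw [hmi i, pd_const_mul (hg1.mul (hgi1 i)), pd_mul hg1 (hgi1 i)]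
    ring
  have hlap : ∀ x, ∑ i, pd (pd m i) i x =
      2 * Z⁻¹ * (g x * ∑ i, pd (pd g i) i x + ∑ i, pd g i x ^ 2) := by
    intro x
    simp only [hmii]
    rw [← Finset.mul_sum, Finset.sum_add_distrib, ← Finset.mul_sum]
  have hH : ∀ x, 2 * ∫ y in torusBox d, ψ (x - y) * m y =
      ρ * u x + 2 * ν ^ 2 * (∑ i, pd (pd g i) i x) / g x := by
    intro x
    rw [← hHJB x]
    have h1 : ∑ i, pd (pd u i) i x =
        (-2 * ν) * ((∑ i, pd (pd g i) i x) / g x - (∑ i, pd g i x ^ 2) / g x ^ 2) := by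
      simp only [huii]
      rw [← Finset.mul_sum, Finset.sum_sub_distrib, ← Finset.sum_div, ← Finset.sum_div]
    have h2 : ∑ i, pd u i x ^ 2 = 4 * ν ^ 2 * ((∑ i, pd g i x ^ 2) / g x ^ 2) := by
      rw [Finset.sum_div, Finset.mul_sum]
      refine Finset.sum_congr rfl fun i _ => ?_
      rw [hui i]
      have := hgne x
      field_simp
      ring
    rw [h1, h2]
    ring
  have hI : ∫ x in torusBox d, (∑ i, (pd m i x) ^ 2) / m x =
      4 * Z⁻¹ * ∫ x in torusBox d, ∑ i, pd g i x ^ 2 := by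
    rw [← integral_const_mul]
    congr 1
    ext x
    rw [Finset.sum_div, Finset.mul_sum]
    refine Finset.sum_congr rfl fun i _ => ?_
    rw [hmi i, hmg]
    have := hgne x
    have := hZpos.ne'
    field_simp
    ring
  have c0 : Continuous g := hg.continuous
  have c1 : ∀ i, Continuous (pd g i) := fun i => pd_cont hg1 i
  have c2 : ∀ i, Continuous (pd (pd g i) i) := fun i => pd_cont (hgi1 i) i
  have hU : ∫ x in torusBox d, u x * ∑ i, pd (pd m i) i x =
      4 * ν * Z⁻¹ * ∫ x in torusBox d, ∑ i, pd g i x ^ 2 := by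
    have hsum : ∫ x in torusBox d, ∑ i, pd g i x ^ 2 = ∑ i, ∫ x in torusBox d, pd g i x ^ 2 :=
      integral_finsetSum _ fun i _ => intBox ((c1 i).pow 2)
    rw [int_lap hm hu.continuous, hsum, Finset.mul_sum]
    refine Finset.sum_congr rfl fun i _ => ?_
    rw [ibp hu1 (pd_contDiff hm i) huper (pd_per hmper i), ← integral_neg, ← integral_const_mul]
    congr 1
    ext x
    rw [hui i, hmi i]
    have := hgne x
    field_simp
    ring
  have cs1 : Continuous (fun x => ∑ i, pd g i x ^ 2) :=
    continuous_finsetSum _ fun i _ => (c1 i).pow 2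
  have cs2 : Continuous (fun x => ∑ i, pd (pd g i) i x) :=
    continuous_finsetSum _ fun i _ => c2 i
  have cs3 : Continuous (fun x => ∑ i, pd (pd m i) i x) :=
    continuous_finsetSum _ fun i _ => pd_cont (pd_contDiff hm i) i
  have ck : Continuous (fun x => (∑ i, pd (pd g i) i x) *
      (∑ i, pd (pd g i) i x + (∑ i, pd g i x ^ 2) / g x)) :=
    cs2.mul (cs2.add (cs1.div₀ c0 hgne))
  have hL : ∫ x in torusBox d, (2 * ∫ y in torusBox d, ψ (x - y) * m y) * ∑ i, pd (pd m i) i x =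
      ρ * (∫ x in torusBox d, u x * ∑ i, pd (pd m i) i x) +
      4 * ν ^ 2 * Z⁻¹ * ∫ x in torusBox d, (∑ i, pd (pd g i) i x) *
        (∑ i, pd (pd g i) i x + (∑ i, pd g i x ^ 2) / g x) := by
    rw [← integral_const_mul, ← integral_const_mul, ← integral_add]
    · congr 1
      ext x
      rw [hH x]
      have e : 2 * ν ^ 2 * (∑ i, pd (pd g i) i x) / g x * ∑ i, pd (pd m i) i x =
          4 * ν ^ 2 * Z⁻¹ * ((∑ i, pd (pd g i) i x) *
            (∑ i, pd (pd g i) i x + (∑ i, pd g i x ^ 2) / g x)) := by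
        rw [hlap x]
        have := hgne x
        field_simp
        ring
      rw [add_mul, e]
      ring
    · exact intBox (continuous_const.mul (hu.continuous.mul cs3))
    · exact intBox (continuous_const.mul ck)
  have hkey := key hg pg hgpos
  change _ ≤ -∑' k : {k : Fin d → ℤ // k ≠ 0}, c k.1 * (∑ i, ((k.1 i : ℝ)) ^ 2) *
        (cC k.1 m ^ 2 + sC k.1 m ^ 2)
  rw [← hpot, hL, hU, hI]
  have h4 : 0 ≤ 4 * ν ^ 2 * Z⁻¹ := by positivity
  have := mul_le_mul_of_nonneg_left hkey h4
  linarith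
end

section
/- Let ν, ρ > 0, and for i = 1, 2 let u_i, m_i : ℝ^d → ℝ be twice continuously differentiable, 2π-periodic in each coordinate, with m_i > 0, ∫_{[0,2π]^d} m_i = 1, and m_i(x) = exp(−u_i(x)/ν)/∫_{[0,2π]^d} exp(−u_i(y)/ν) dy. Let f_1, f_2 : ℝ^d → ℝ be continuous and 2π-periodic in each coordinate, and suppose that for i = 1, 2: ρ u_i − ν Δu_i + ½|∇u_i|² = f_i on ℝ^d, and ν Δm_i + ∇·(m_i ∇u_i) = 0 on ℝ^d. Then ∫_{[0,2π]^d} (f_1 − f_2)(m_1 − m_2) dx = −ρν ∫_{[0,2π]^d} (log m_1 − log m_2)(m_1 − m_2) dx − ½ ∫_{[0,2π]^d} (m_1 + m_2) |∇u_1 − ∇u_2|² dx. -/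
open Real MeasureTheory

theorem aux_div {d : ℕ} (F : Fin d → (Fin d → ℝ) → ℝ) (hF : ∀ i, ContDiff ℝ 1 (F i))
    (hper : ∀ i x, F i (x + Pi.single i (2 * π)) = F i x) :
    (∫ x in torusBox d, ∑ i, pd (F i) i x) = 0 := by
  cases d with
  | zero => simp
  | succ n =>
    have hc : Continuous (fun x => ∑ i, pd (F i) i x) := by
      refine continuous_finsetSum _ fun i _ => ?_
      exact ((hF i).continuous_fderiv (by norm_num)).clm_apply continuous_const
    have hle : (0 : Fin (n+1) → ℝ) ≤ (fun _ => 2 * π) := fun i => by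
      simp only [Pi.zero_apply]; positivity
    have key := integral_divergence_of_hasFDerivAt_off_countable' (0 : Fin (n+1) → ℝ)
      (fun _ => 2 * π) hle F (fun i x => fderiv ℝ (F i) x) ∅ Set.countable_empty
      (fun i => (hF i).continuous.continuousOn)
      (fun x _ i => ((hF i).differentiable (by norm_num) x).hasFDerivAt)
      (hc.continuousOn.integrableOn_compact isCompact_Icc)
    unfold torusBox
    refine key.trans (Finset.sum_eq_zero fun i _ => ?_)
    rw [sub_eq_zero]
    congr 1
    funext y
    refine Eq.trans ?_ (hper i _)
    congr 1
    ext j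
    refine Fin.succAboveCases i ?_ (fun k => ?_) j
    · simp
    · simp

theorem aux_pd_contDiff {d : ℕ} {u : (Fin d → ℝ) → ℝ} (hu : ContDiff ℝ 2 u) (i : Fin d) :
    ContDiff ℝ 1 (pd u i) :=
  (hu.fderiv_right (m := 1) (by norm_num)).clm_apply contDiff_const

theorem aux_pd_per {d : ℕ} {u : (Fin d → ℝ) → ℝ} (v : Fin d → ℝ)
    (h : ∀ x, u (x + v) = u x) (i : Fin d) (x : Fin d → ℝ) :
    pd u i (x + v) = pd u i x := by
  unfold pd
  rw [← fderiv_comp_add_right v]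
  simp only [h]

theorem aux_gibbs {d : ℕ} {ν : ℝ} (hν : 0 < ν) {u m : (Fin d → ℝ) → ℝ} (Z : ℝ)
    (hu : ContDiff ℝ 2 u) (hpos : ∀ x, 0 < m x)
    (hg : ∀ x, m x = Real.exp (-u x / ν) / Z) :
    (∀ x, u x = -ν * Real.log (m x) - ν * Real.log Z) ∧
      ∀ i x, ν * pd m i x = - (m x * pd u i x) := by
  have hZ : Z ≠ 0 := by
    rintro rfl
    have := hpos 0
    rw [hg] at this
    simp at this
  constructor
  · intro x
    rw [hg, Real.log_div (Real.exp_ne_zero _) hZ, Real.log_exp]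
    field_simp
    ring
  · intro i x
    have h1 := ((hu.differentiable (by norm_num) x).hasFDerivAt.neg.mul_const ν⁻¹).exp.mul_const Z⁻¹
    have h2 : m = fun x => Real.exp (-u x * ν⁻¹) * Z⁻¹ := by
      funext x; rw [hg x]; simp [div_eq_mul_inv]
    have h3 := h1.congr_of_eventuallyEq (f₁ := m)
      (Filter.Eventually.of_forall fun y => by rw [h2]; rfl)
    unfold pd
    rw [h3.fderiv, h2]
    simp
    field_simp

theorem aux_pd_mul {d : ℕ} {a b m n : (Fin d → ℝ) → ℝ} (ha : ContDiff ℝ 1 a)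
    (hb : ContDiff ℝ 1 b) (hm : ContDiff ℝ 2 m) (hn : ContDiff ℝ 2 n) (i : Fin d)
    (x : Fin d → ℝ) :
    pd (fun y => (a y - b y) * (m y - n y)) i x =
      (pd a i x - pd b i x) * (m x - n x) + (a x - b x) * (pd m i x - pd n i x) := by
  have h := ((ha.differentiable (by norm_num) x).hasFDerivAt.sub
    (hb.differentiable (by norm_num) x).hasFDerivAt).mul
    ((hm.differentiable (by norm_num) x).hasFDerivAt.sub
    (hn.differentiable (by norm_num) x).hasFDerivAt)
  have h3 : HasFDerivAt (fun y => (a y - b y) * (m y - n y)) _ x := h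
  unfold pd
  rw [h3.fderiv]
  simp
  ring

/-- Duality identity for two stationary mean-field game systems on
`𝕋^d`: with interaction costs `f₁, f₂`,
`∫ (f₁−f₂)(m₁−m₂) = −ρν ∫ (log m₁ − log m₂)(m₁−m₂) − ½ ∫ (m₁+m₂)|∇u₁−∇u₂|²`. -/
theorem stationary_duality_identity (d : ℕ) (ν ρ : ℝ) (hν : 0 < ν) (hρ : 0 < ρ)
    (u₁ u₂ m₁ m₂ : (Fin d → ℝ) → ℝ) (f₁ f₂ : (Fin d → ℝ) → ℝ)
    (hu₁ : ContDiff ℝ 2 u₁) (hu₂ : ContDiff ℝ 2 u₂)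
    (hm₁ : ContDiff ℝ 2 m₁) (hm₂ : ContDiff ℝ 2 m₂)
    (hf₁ : Continuous f₁) (hf₂ : Continuous f₂)
    (huper₁ : ∀ (x : Fin d → ℝ) (i : Fin d), u₁ (x + Pi.single i (2 * π)) = u₁ x)
    (huper₂ : ∀ (x : Fin d → ℝ) (i : Fin d), u₂ (x + Pi.single i (2 * π)) = u₂ x)
    (hmper₁ : ∀ (x : Fin d → ℝ) (i : Fin d), m₁ (x + Pi.single i (2 * π)) = m₁ x)
    (hmper₂ : ∀ (x : Fin d → ℝ) (i : Fin d), m₂ (x + Pi.single i (2 * π)) = m₂ x)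
    (hfper₁ : ∀ (x : Fin d → ℝ) (i : Fin d), f₁ (x + Pi.single i (2 * π)) = f₁ x)
    (hfper₂ : ∀ (x : Fin d → ℝ) (i : Fin d), f₂ (x + Pi.single i (2 * π)) = f₂ x)
    (hmpos₁ : ∀ x, 0 < m₁ x) (hmpos₂ : ∀ x, 0 < m₂ x)
    (hmass₁ : (∫ x in torusBox d, m₁ x) = 1) (hmass₂ : (∫ x in torusBox d, m₂ x) = 1)
    (hgibbs₁ : ∀ x, m₁ x =
      Real.exp (-u₁ x / ν) / ∫ y in torusBox d, Real.exp (-u₁ y / ν))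
    (hgibbs₂ : ∀ x, m₂ x =
      Real.exp (-u₂ x / ν) / ∫ y in torusBox d, Real.exp (-u₂ y / ν))
    (hHJB₁ : ∀ x, ρ * u₁ x - ν * (∑ i, pd (pd u₁ i) i x) +
      (1 / 2) * (∑ i, (pd u₁ i x) ^ 2) = f₁ x)
    (hHJB₂ : ∀ x, ρ * u₂ x - ν * (∑ i, pd (pd u₂ i) i x) +
      (1 / 2) * (∑ i, (pd u₂ i x) ^ 2) = f₂ x)
    (hFP₁ : ∀ x, ν * (∑ i, pd (pd m₁ i) i x) +
      (∑ i, pd (fun y => m₁ y * pd u₁ i y) i x) = 0)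
    (hFP₂ : ∀ x, ν * (∑ i, pd (pd m₂ i) i x) +
      (∑ i, pd (fun y => m₂ y * pd u₂ i y) i x) = 0) :
    (∫ x in torusBox d, (f₁ x - f₂ x) * (m₁ x - m₂ x)) =
      -(ρ * ν) * (∫ x in torusBox d,
          (Real.log (m₁ x) - Real.log (m₂ x)) * (m₁ x - m₂ x)) -
        (1 / 2) * ∫ x in torusBox d,
          (m₁ x + m₂ x) * (∑ i, (pd u₁ i x - pd u₂ i x) ^ 2) := by
  obtain ⟨hlog₁, hgr₁⟩ := aux_gibbs hν _ hu₁ hmpos₁ hgibbs₁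
  obtain ⟨hlog₂, hgr₂⟩ := aux_gibbs hν _ hu₂ hmpos₂ hgibbs₂
  set Z₁ := ∫ y in torusBox d, Real.exp (-u₁ y / ν)
  set Z₂ := ∫ y in torusBox d, Real.exp (-u₂ y / ν)
  have hp₁ := fun i => aux_pd_contDiff hu₁ i
  have hp₂ := fun i => aux_pd_contDiff hu₂ i
  set F : Fin d → (Fin d → ℝ) → ℝ :=
    fun i y => (pd u₁ i y - pd u₂ i y) * (m₁ y - m₂ y) with hFdef
  have hF : ∀ i, ContDiff ℝ 1 (F i) := fun i =>
    ((hp₁ i).sub (hp₂ i)).mul ((hm₁.sub hm₂).of_le (by norm_num))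
  have hdiv := aux_div F hF (fun i x => by
    simp only [hFdef]
    rw [aux_pd_per _ (fun x => huper₁ x i), aux_pd_per _ (fun x => huper₂ x i), hmper₁, hmper₂])
  have hint : ∀ g : (Fin d → ℝ) → ℝ, Continuous g → IntegrableOn g (torusBox d) :=
    fun g hg => hg.continuousOn.integrableOn_compact isCompact_Icc
  have cm₁ := hm₁.continuous
  have cm₂ := hm₂.continuous
  have cl₁ : Continuous (fun x => Real.log (m₁ x)) := cm₁.log fun x => (hmpos₁ x).ne'
  have cl₂ : Continuous (fun x => Real.log (m₂ x)) := cm₂.log fun x => (hmpos₂ x).ne'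
  have iA := hint (fun x => (Real.log (m₁ x) - Real.log (m₂ x)) * (m₁ x - m₂ x))
    ((cl₁.sub cl₂).mul (cm₁.sub cm₂))
  have iB := hint (fun x => (m₁ x + m₂ x) * (∑ i, (pd u₁ i x - pd u₂ i x) ^ 2))
    ((cm₁.add cm₂).mul (continuous_finsetSum _ fun i _ =>
      (((hp₁ i).continuous.sub (hp₂ i).continuous).pow 2)))
  have iC := hint (fun x => ∑ i, pd (F i) i x) (continuous_finsetSum _ fun i _ =>
    ((hF i).continuous_fderiv (by norm_num)).clm_apply continuous_const)
  have iD := (hint m₁ cm₁).sub (hint m₂ cm₂)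
  have hD : (∫ x in torusBox d, (m₁ x - m₂ x)) = 0 := by
    rw [integral_sub (hint m₁ cm₁) (hint m₂ cm₂), hmass₁, hmass₂, sub_self]
  have hpt : ∀ x, (f₁ x - f₂ x) * (m₁ x - m₂ x) =
      (-(ρ * ν) * ((Real.log (m₁ x) - Real.log (m₂ x)) * (m₁ x - m₂ x)) -
        (1 / 2) * ((m₁ x + m₂ x) * (∑ i, (pd u₁ i x - pd u₂ i x) ^ 2))) -
      (ν * (∑ i, pd (F i) i x) +
        (ρ * ν * (Real.log Z₁ - Real.log Z₂)) * (m₁ x - m₂ x)) := by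
    intro x
    have hs : -ν * (∑ i, pd (pd u₁ i) i x) * (m₁ x - m₂ x)
        + ν * (∑ i, pd (pd u₂ i) i x) * (m₁ x - m₂ x)
        + (1 / 2) * (∑ i, (pd u₁ i x) ^ 2) * (m₁ x - m₂ x)
        - (1 / 2) * (∑ i, (pd u₂ i x) ^ 2) * (m₁ x - m₂ x)
        + (1 / 2) * ((m₁ x + m₂ x) * (∑ i, (pd u₁ i x - pd u₂ i x) ^ 2))
        + ν * (∑ i, pd (F i) i x) = 0 := by
      simp only [Finset.mul_sum, Finset.sum_mul, ← Finset.sum_add_distrib,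
        ← Finset.sum_sub_distrib]
      refine Finset.sum_eq_zero fun i _ => ?_
      simp only [hFdef]
      rw [aux_pd_mul (hp₁ i) (hp₂ i) hm₁ hm₂]
      linear_combination (pd u₁ i x - pd u₂ i x) * (hgr₁ i x - hgr₂ i x)
    rw [← hHJB₁, ← hHJB₂]
    linear_combination hs + ρ * (m₁ x - m₂ x) * (hlog₁ x - hlog₂ x)
  simp only [hpt]
  rw [integral_sub, integral_sub, integral_add, integral_const_mul, integral_const_mul,
    integral_const_mul, integral_const_mul, hdiv, hD]
  · ring
  · exact iC.const_mul _
  · exact iD.const_mul _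
  · exact iA.const_mul _
  · exact iB.const_mul _
  · exact (iA.const_mul _).sub (iB.const_mul _)
  · exact (iC.const_mul _).add (iD.const_mul _)
end
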